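/- Let τ ∈ ℂ with Im τ > 0 and θ(z) = θ₁(z,τ). Let w, X, X', Y, Y', Z, Z' ∈ ℂ be such that θ(X'−Z), θ(Y'−Z'), θ(w−X+Y'−Y+Z'−Z) and θ(w−Y+X'−X) are all nonzero. Define X₄ = [θ(X'−Z')·θ(Y'−Z)·θ(w−X+Y'−Y)·θ(w−Y+X'−X+Z'−Z)] / [θ(X'−Z)·θ(Y'−Z')·θ(w−X+Y'−Y+Z'−Z)·θ(w−Y+X'−X)] and Y₄ = [θ(Z−Z')·θ(X'−Y')·θ(w−Z+X'−X+Y'−Y)·θ(w−Y+Z'−X)] / [θ(X'−Z)·θ(Y'−Z')·θ(w−X+Y'−Y+Z'−Z)·θ(w−Y+X'−X)]. Then X₄ + Y₄ = 1. (This is the Fermat relation x₄^N + y₄^N = 1 for the fourth Fermat point of the theta-function parameterized R-matrix, in genus one.) -/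

import Mathlib

/-- The odd Jacobi theta function
`θ₁(z,τ) = -i ∑_{n ∈ ℤ} (-1)^n exp(iπτ(n+1/2)²) exp((2n+1)iπz)`. -/
noncomputable def theta1 (z τ : ℂ) : ℂ :=
  -Complex.I * ∑' n : ℤ,
    (-1 : ℂ) ^ n * Complex.exp ((Real.pi : ℂ) * Complex.I * τ * ((n : ℂ) + 1 / 2) ^ 2) *
      Complex.exp ((2 * (n : ℂ) + 1) * (Real.pi : ℂ) * Complex.I * z)

/-- The decomposition of `ℤ × ℤ` into the pairs with odd and with even difference. -/
noncomputable def intProdParityEquiv : (ℤ × ℤ) ⊕ (ℤ × ℤ) ≃ ℤ × ℤ :=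
  Equiv.ofBijective
    (Sum.elim (fun p => (p.1 + p.2, p.1 - p.2 - 1)) (fun p => (p.1 + p.2, p.1 - p.2))) <| by
  constructor
  · rintro (⟨a, b⟩ | ⟨a, b⟩) (⟨c, d⟩ | ⟨c, d⟩) h <;>
      simp only [Sum.elim_inl, Sum.elim_inr, Prod.mk.injEq] at h
    · obtain ⟨rfl, rfl⟩ : a = c ∧ b = d := by omega
      rfl
    · omega
    · omega
    · obtain ⟨rfl, rfl⟩ : a = c ∧ b = d := by omega
      rfl
  · rintro ⟨m, n⟩
    rcases Int.even_or_odd' (m - n) with ⟨l, hl | hl⟩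
    · exact ⟨Sum.inr (n + l, l), by simp only [Sum.elim_inr, Prod.mk.injEq]; omega⟩
    · exact ⟨Sum.inl (n + l + 1, l), by simp only [Sum.elim_inl, Prod.mk.injEq]; omega⟩

/-- The general term of the series defining `theta1`. -/
noncomputable def theta1Term (z τ : ℂ) (n : ℤ) : ℂ :=
  (-1 : ℂ) ^ n * Complex.exp ((Real.pi : ℂ) * Complex.I * τ * ((n : ℂ) + 1 / 2) ^ 2) *
    Complex.exp ((2 * (n : ℂ) + 1) * (Real.pi : ℂ) * Complex.I * z)

/-- The general term of the half-period shifted theta series of modulus `2 * τ`. -/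
noncomputable def oddThetaTerm (z τ : ℂ) (n : ℤ) : ℂ :=
  Complex.exp (2 * Real.pi * Complex.I * (τ * ((n : ℂ) + 1 / 2) ^ 2 + (2 * n + 1) * z))

lemma summable_theta1Term (z : ℂ) {τ : ℂ} (hτ : 0 < τ.im) : Summable (theta1Term z τ) := by
  have h := ((summable_jacobiTheta₂_term_iff (z + τ / 2 + 1 / 2) τ).2 hτ).mul_left
    (Complex.exp (Real.pi * Complex.I * (τ / 4 + z)))
  refine h.congr fun n => ?_
  have h1 : (-1 : ℂ) ^ n = Complex.exp (n * (Real.pi * Complex.I)) := by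
    rw [Complex.exp_int_mul, Complex.exp_pi_mul_I]
  rw [theta1Term, jacobiTheta₂_term, h1, ← Complex.exp_add, ← Complex.exp_add, ← Complex.exp_add]
  congr 1
  ring

lemma summable_oddThetaTerm (z : ℂ) {τ : ℂ} (hτ : 0 < τ.im) : Summable (oddThetaTerm z τ) := by
  have h := ((summable_jacobiTheta₂_term_iff (2 * z + τ) (2 * τ)).2 (by simpa using hτ)).mul_left
    (Complex.exp (2 * Real.pi * Complex.I * (τ / 4 + z)))
  refine h.congr fun n => ?_
  rw [oddThetaTerm, jacobiTheta₂_term, ← Complex.exp_add]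
  congr 1
  ring

lemma theta1Term_mul_theta1Term_of_odd (x y τ : ℂ) (k l : ℤ) :
    theta1Term (x + y) τ (k + l) * theta1Term (x - y) τ (k - l - 1) =
      -(jacobiTheta₂_term k (2 * x) (2 * τ) * oddThetaTerm y τ l) := by
  have h1 : (-1 : ℂ) ^ (k + l) * (-1 : ℂ) ^ (k - l - 1) = -1 := by
    rw [← zpow_add₀ (by norm_num), show k + l + (k - l - 1) = 2 * (k - 1) + 1 by ring]
    exact Odd.neg_one_zpow (odd_two_mul_add_one _)
  rw [theta1Term, theta1Term, oddThetaTerm, jacobiTheta₂_term, mul_mul_mul_comm,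
    mul_mul_mul_comm ((-1 : ℂ) ^ (k + l)), h1, neg_mul, one_mul, neg_mul, neg_inj]
  simp only [← Complex.exp_add]
  congr 1
  push_cast
  ring

lemma theta1Term_mul_theta1Term_of_even (x y τ : ℂ) (k l : ℤ) :
    theta1Term (x + y) τ (k + l) * theta1Term (x - y) τ (k - l) =
      oddThetaTerm x τ k * jacobiTheta₂_term l (2 * y) (2 * τ) := by
  have h1 : (-1 : ℂ) ^ (k + l) * (-1 : ℂ) ^ (k - l) = 1 := by
    rw [← zpow_add₀ (by norm_num), show k + l + (k - l) = 2 * k by ring]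
    exact Even.neg_one_zpow (even_two_mul _)
  rw [theta1Term, theta1Term, oddThetaTerm, jacobiTheta₂_term, mul_mul_mul_comm,
    mul_mul_mul_comm ((-1 : ℂ) ^ (k + l)), h1, one_mul]
  simp only [← Complex.exp_add]
  congr 1
  push_cast
  ring

/-- The addition formula expressing `θ₁(x+y)θ₁(x-y)` through theta functions of modulus `2τ`. -/
lemma theta1_add_mul_theta1_sub (x y : ℂ) {τ : ℂ} (hτ : 0 < τ.im) :
    theta1 (x + y) τ * theta1 (x - y) τ =
      jacobiTheta₂ (2 * x) (2 * τ) * (∑' n, oddThetaTerm y τ n) -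
        (∑' n, oddThetaTerm x τ n) * jacobiTheta₂ (2 * y) (2 * τ) := by
  have hT (z : ℂ) := (summable_theta1Term z hτ).norm
  have hO (z : ℂ) := (summable_oddThetaTerm z hτ).norm
  have hJ (z : ℂ) : Summable fun n => ‖jacobiTheta₂_term n (2 * z) (2 * τ)‖ :=
    ((summable_jacobiTheta₂_term_iff (2 * z) (2 * τ)).2 (by simpa using hτ)).norm
  have key : (∑' n, theta1Term (x + y) τ n) * (∑' n, theta1Term (x - y) τ n) =
      -(jacobiTheta₂ (2 * x) (2 * τ) * (∑' n, oddThetaTerm y τ n)) +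
        (∑' n, oddThetaTerm x τ n) * jacobiTheta₂ (2 * y) (2 * τ) := by
    rw [tsum_mul_tsum_of_summable_norm (hT _) (hT _), jacobiTheta₂, jacobiTheta₂,
      tsum_mul_tsum_of_summable_norm (hJ x) (hO y), tsum_mul_tsum_of_summable_norm (hO x) (hJ y),
      ← intProdParityEquiv.tsum_eq, ← tsum_neg]
    refine HasSum.tsum_eq (HasSum.sum ?_ ?_)
    · exact (summable_mul_of_summable_norm (hJ x) (hO y)).neg.hasSum.congr_fun fun p =>
        theta1Term_mul_theta1Term_of_odd x y τ p.1 p.2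
    · exact (summable_mul_of_summable_norm (hO x) (hJ y)).hasSum.congr_fun fun p =>
        theta1Term_mul_theta1Term_of_even x y τ p.1 p.2
  have hdef (z : ℂ) : theta1 z τ = -Complex.I * ∑' n, theta1Term z τ n := rfl
  rw [hdef, hdef, mul_mul_mul_comm, key, neg_mul_neg, Complex.I_mul_I]
  ring

/-- The Weierstrass three-term identity for `theta1`. -/
lemma theta1_three_term (a b c d : ℂ) {τ : ℂ} (hτ : 0 < τ.im) :
    (theta1 (a + c) τ * theta1 (a - c) τ) * (theta1 (b + d) τ * theta1 (b - d) τ) +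
      (theta1 (d + c) τ * theta1 (d - c) τ) * (theta1 (a + b) τ * theta1 (a - b) τ) =
    (theta1 (a + d) τ * theta1 (a - d) τ) * (theta1 (b + c) τ * theta1 (b - c) τ) := by
  simp only [theta1_add_mul_theta1_sub _ _ hτ]
  ring

/-- Genus-one Fermat relation `x₄^N + y₄^N = 1` for the fourth Fermat
point of the theta-function parameterized R-matrix: with `θ(z) = θ₁(z,τ)`, `Im τ > 0`,
and the stated denominators nonzero,
`X₄ = θ(X'-Z')θ(Y'-Z)θ(w-X+Y'-Y)θ(w-Y+X'-X+Z'-Z)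
      / (θ(X'-Z)θ(Y'-Z')θ(w-X+Y'-Y+Z'-Z)θ(w-Y+X'-X))` and
`Y₄ = θ(Z-Z')θ(X'-Y')θ(w-Z+X'-X+Y'-Y)θ(w-Y+Z'-X)
      / (θ(X'-Z)θ(Y'-Z')θ(w-X+Y'-Y+Z'-Z)θ(w-Y+X'-X))`
satisfy `X₄ + Y₄ = 1`. -/
theorem theta1_fermat_relation_fourth (τ : ℂ) (hτ : 0 < τ.im)
    (w X X' Y Y' Z Z' : ℂ)
    (h1 : theta1 (X' - Z) τ ≠ 0) (h2 : theta1 (Y' - Z') τ ≠ 0)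
    (h3 : theta1 (w - X + Y' - Y + Z' - Z) τ ≠ 0)
    (h4 : theta1 (w - Y + X' - X) τ ≠ 0) :
    (theta1 (X' - Z') τ * theta1 (Y' - Z) τ * theta1 (w - X + Y' - Y) τ *
        theta1 (w - Y + X' - X + Z' - Z) τ) /
      (theta1 (X' - Z) τ * theta1 (Y' - Z') τ * theta1 (w - X + Y' - Y + Z' - Z) τ *
        theta1 (w - Y + X' - X) τ) +
    (theta1 (Z - Z') τ * theta1 (X' - Y') τ * theta1 (w - Z + X' - X + Y' - Y) τ *
        theta1 (w - Y + Z' - X) τ) /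
      (theta1 (X' - Z) τ * theta1 (Y' - Z') τ * theta1 (w - X + Y' - Y + Z' - Z) τ *
        theta1 (w - Y + X' - X) τ) = 1 := by
  have h := theta1_three_term (X' - Z + (w - X - Y + Z) / 2) (Y' - Z + (w - X - Y + Z) / 2)
    (Z' - Z + (w - X - Y + Z) / 2) ((w - X - Y + Z) / 2) hτ
  rw [← add_div, div_eq_one_iff_eq (by simp [h1, h2, h3, h4])]
  ring_nf at h ⊢
  linear_combination h
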